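/- Let k be a field. Inside the field of Hahn series over the linearly ordered abelian group ℝ with coefficients in k, the set Λ_k of series x whose support {λ ∈ ℝ | coeff of x at λ ≠ 0} has finite intersection with the interval (−∞, c] for every c ∈ ℝ is a subfield: it contains 0 and 1, and is closed under addition, negation, multiplication, and taking inverses of nonzero elements. -/

import Mathlib

/-- An element of the Hahn series field `HahnSeries ℝ k` belongs to the Novikov field
`Λ_k` if its support meets `(-∞, c]` in a finite set for every `c : ℝ`. -/
def IsNovikov {k : Type*} [Field k] (x : HahnSeries ℝ k) : Prop :=
  ∀ c : ℝ, ({l : ℝ | x.coeff l ≠ 0} ∩ Set.Iic c).Finite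

namespace IsNovikov

open HahnSeries Pointwise

variable {k : Type*} [Field k] {x y : HahnSeries ℝ k}

theorem of_support_subset_singleton {a : ℝ} (h : x.support ⊆ {a}) : IsNovikov x :=
  fun _ => ((Set.finite_singleton a).subset h).inter_of_left _

theorem single (a : ℝ) (r : k) : IsNovikov (HahnSeries.single a r) :=
  of_support_subset_singleton support_single_subset

theorem zero : IsNovikov (0 : HahnSeries ℝ k) := by
  simpa using single (0 : ℝ) (0 : k)

theorem one : IsNovikov (1 : HahnSeries ℝ k) :=
  single 0 1

theorem add (hx : IsNovikov x) (hy : IsNovikov y) : IsNovikov (x + y) := fun c =>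
  ((hx c).union (hy c)).subset <| by
    rw [← Set.union_inter_distrib_right]
    exact Set.inter_subset_inter_left _ (support_add_subset x y)

theorem neg (hx : IsNovikov x) : IsNovikov (-x) := fun c =>
  (hx c).subset (Set.inter_subset_inter_left _ (support_neg_subset x))

theorem mul (hx : IsNovikov x) (hy : IsNovikov y) : IsNovikov (x * y) := fun c => by
  refine ((hx (c - y.order)).add (hy (c - x.order))).subset ?_
  rintro l ⟨hl, hlc⟩
  obtain ⟨a, ha, b, hb, rfl⟩ := support_mul_subset hl
  have hxa := order_le_of_coeff_ne_zero ha
  have hyb := order_le_of_coeff_ne_zero hb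
  simp only [Set.mem_Iic] at hlc
  exact Set.add_mem_add ⟨ha, by simp only [Set.mem_Iic]; linarith⟩
    ⟨hb, by simp only [Set.mem_Iic]; linarith⟩

theorem pow (hx : IsNovikov x) (n : ℕ) : IsNovikov (x ^ n) := by
  induction n with
  | zero => simpa using one
  | succ n ih => simpa [pow_succ] using ih.mul hx

/-- A positive lower bound for the support of `x` makes only finitely many powers of `x`
contribute to the geometric series below any given `c`. -/
theorem hsum_powers (hx : IsNovikov x) (hpos : 0 < x.orderTop) :
    IsNovikov (SummableFamily.powers x).hsum := fun c => by
  obtain ⟨d, hd, hdx⟩ : ∃ d : ℝ, 0 < d ∧ (d : WithTop ℝ) ≤ x.orderTop := by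
    cases h : x.orderTop with
    | top => exact ⟨1, one_pos, le_top⟩
    | coe d => exact ⟨d, by simpa [h] using hpos, le_rfl⟩
  obtain ⟨N, hN⟩ := exists_nat_gt (c / d)
  refine ((Set.finite_lt_nat N).biUnion fun n _ => hx.pow n c).subset ?_
  rintro l ⟨hl, hlc⟩
  obtain ⟨n, hn⟩ := Set.mem_iUnion.mp (SummableFamily.support_hsum_subset hl)
  rw [SummableFamily.powers_of_orderTop_pos hpos] at hn
  have hle : ((n • d : ℝ) : WithTop ℝ) ≤ l := by
    rw [WithTop.coe_nsmul]
    exact (nsmul_le_nsmul_right hdx n).trans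
      (orderTop_nsmul_le_orderTop_pow.trans (orderTop_le_of_coeff_ne_zero hn))
  have hnd : n * d ≤ l := by simpa using WithTop.coe_le_coe.mp hle
  have hnN : (n : ℝ) < N := ((le_div_iff₀ hd).mpr (hnd.trans hlc)).trans_lt hN
  exact Set.mem_biUnion (show n ∈ {i | i < N} from Nat.cast_lt.mp hnN) ⟨hn, hlc⟩

theorem inv (hx : IsNovikov x) (hx0 : x ≠ 0) : IsNovikov x⁻¹ := by
  rw [inv_def]
  refine (single _ _).mul (hsum_powers ?_ ?_)
  · rw [sub_eq_add_neg]
    exact one.add ((single _ _).mul hx).neg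
  · exact unit_aux x (inv_mul_cancel₀ (leadingCoeff_ne_zero.mpr hx0)) _ (neg_add_cancel x.order)

end IsNovikov

/-- The Novikov field `Λ_k` is a subfield of the field of Hahn series over `ℝ` with
coefficients in `k`: it contains `0` and `1`, and is closed under addition, negation,
multiplication, and inverses of nonzero elements. -/
theorem novikov_is_subfield (k : Type*) [Field k] :
    IsNovikov (0 : HahnSeries ℝ k) ∧
    IsNovikov (1 : HahnSeries ℝ k) ∧
    (∀ x y : HahnSeries ℝ k, IsNovikov x → IsNovikov y → IsNovikov (x + y)) ∧
    (∀ x : HahnSeries ℝ k, IsNovikov x → IsNovikov (-x)) ∧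
    (∀ x y : HahnSeries ℝ k, IsNovikov x → IsNovikov y → IsNovikov (x * y)) ∧
    (∀ x : HahnSeries ℝ k, x ≠ 0 → IsNovikov x → IsNovikov x⁻¹) :=
  ⟨.zero, .one, fun _ _ => .add, fun _ => .neg, fun _ _ => .mul, fun _ hx0 hx => hx.inv hx0⟩
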